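/- Let α ∈ [0,1], β = √(1−α²), and c > 0. The Serret–Frenet system m′ = k n, n′ = −k m + τ b, b′ = −τ n on ℝ, with curvature k(x) = c e^{−αx²/4}, torsion τ(x) = βx/2, and initial conditions m(0) = e₁, n(0) = e₂, b(0) = e₃, has a unique global solution (m_{c,α}, n_{c,α}, b_{c,α}) ∈ (C^∞(ℝ; ℝ³))³; for every x ∈ ℝ the vectors {m_{c,α}(x), n_{c,α}(x), b_{c,α}(x)} form an orthonormal basis of ℝ³ (in particular m_{c,α} is S²-valued); and m_{c,α} satisfies the expander profile equation α m″ + α|m′|² m + β (m × m′)′ + (x/2) m′ = 0 with |m_{c,α}′(x)| = c e^{−αx²/4} for all x ∈ ℝ. -/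

import Mathlib

noncomputable section

open Real MeasureTheory Filter Topology
open scoped RealInnerProductSpace

/-- `E3` is `ℝ³` with the Euclidean norm. -/
abbrev E3 : Type := EuclideanSpace ℝ (Fin 3)

def toE3 (v : Fin 3 → ℝ) : E3 := (WithLp.equiv 2 (Fin 3 → ℝ)).symm v

/-- The cross product in `ℝ³`. -/
def cross (a b : E3) : E3 :=
  toE3 ![a 1 * b 2 - a 2 * b 1, a 2 * b 0 - a 0 * b 2, a 0 * b 1 - a 1 * b 0]

def e1 : E3 := EuclideanSpace.single 0 1
def e2 : E3 := EuclideanSpace.single 1 1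
def e3 : E3 := EuclideanSpace.single 2 1

/-- `(m, n, b)` solves the Serret–Frenet system with curvature `k(x) = c e^{-αx²/4}`,
torsion `τ(x) = βx/2` and initial conditions `(e₁, e₂, e₃)`. -/
def IsSF (α β c : ℝ) (m n b : ℝ → E3) : Prop :=
  (∀ x : ℝ, HasDerivAt m ((c * Real.exp (-α * x ^ 2 / 4)) • n x) x) ∧
  (∀ x : ℝ, HasDerivAt n
    ((-(c * Real.exp (-α * x ^ 2 / 4))) • m x + (β * x / 2) • b x) x) ∧
  (∀ x : ℝ, HasDerivAt b ((-(β * x / 2)) • n x) x) ∧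
  m 0 = e1 ∧ n 0 = e2 ∧ b 0 = e3

/-- An integral curve of a time-dependent vector field that is pointwise orthogonal to the curve
has constant norm. -/
theorem norm_sq_eq_of_inner_deriv_eq_zero {E : Type*} [NormedAddCommGroup E]
    [InnerProductSpace ℝ E] {y y' : ℝ → E} {T : ℝ}
    (hy : ∀ t ∈ Set.Ioo (-T) T, HasDerivAt y (y' t) t)
    (h : ∀ t ∈ Set.Ioo (-T) T, ⟪y t, y' t⟫ = 0) {t : ℝ} (ht : t ∈ Set.Ioo (-T) T) :
    ‖y t‖ ^ 2 = ‖y 0‖ ^ 2 := by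
  have h0 : (0 : ℝ) ∈ Set.Ioo (-T) T := by constructor <;> linarith [ht.1, ht.2]
  have hd : ∀ s ∈ Set.Ioo (-T) T, HasDerivAt (fun s => ‖y s‖ ^ 2) 0 s := fun s hs => by
    simpa [h s hs] using (hy s hs).norm_sq
  exact isOpen_Ioo.is_const_of_deriv_eq_zero isPreconnected_Ioo
    (fun s hs => (hd s hs).differentiableAt.differentiableWithinAt)
    (fun s hs => (hd s hs).deriv) ht h0

/-- A linear system with continuous skew-symmetric coefficients is solvable on every bounded
interval, for unit initial data. -/
theorem exists_hasDerivAt_Ioo_of_skew {E : Type*} [NormedAddCommGroup E]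
    [InnerProductSpace ℝ E] [FiniteDimensional ℝ E] {A : ℝ → E →L[ℝ] E} (hA : Continuous A)
    (hskew : ∀ t v, ⟪v, A t v⟫ = 0) {x₀ : E} (hx₀ : ‖x₀‖ = 1) {T : ℝ} (hT : 0 ≤ T) :
    ∃ y : ℝ → E, y 0 = x₀ ∧ ∀ t ∈ Set.Ioo (-T) T, HasDerivAt y (A t (y t)) t := by
  -- Damping the field at infinity makes it bounded without changing it on the unit sphere.
  let P : E → E := fun v => (2 / (1 + ‖v‖ ^ 2)) • v
  have hpos : ∀ v : E, 0 < 1 + ‖v‖ ^ 2 := fun v => by positivity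
  have hP : ContDiff ℝ 1 P :=
    (contDiff_const.div (contDiff_const.add (contDiff_norm_sq ℝ)) fun v => (hpos v).ne').smul
      contDiff_id
  have hP1 : ∀ v, ‖P v‖ ≤ 1 := fun v => by
    have : 0 ≤ 2 / (1 + ‖v‖ ^ 2) := by positivity
    simp only [P, norm_smul, Real.norm_of_nonneg this]
    rw [div_mul_eq_mul_div, div_le_one (hpos v)]
    nlinarith [sq_nonneg (‖v‖ - 1)]
  obtain ⟨M, hM⟩ := (isCompact_Icc (a := -T) (b := T)).exists_bound_of_continuousOn
    hA.continuousOn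
  have hM0 : 0 ≤ M := (norm_nonneg _).trans (hM 0 (by constructor <;> linarith))
  lift M to NNReal using hM0
  lift T to NNReal using hT
  obtain ⟨K, hK⟩ := (hP.locallyLipschitz.locallyLipschitzOn
    (s := Metric.closedBall x₀ ((M * T : NNReal) : ℝ))).exists_lipschitzOnWith_of_compact
      (isCompact_closedBall _ _)
  have h0 : (0 : ℝ) ∈ Set.Icc (-(T : ℝ)) T := by constructor <;> simp
  have hPL : IsPicardLindelof (fun t v => A t (P v)) (⟨0, h0⟩ : Set.Icc (-(T : ℝ)) T) x₀
      (M * T) 0 M (M * K) := by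
    refine ⟨fun t ht => ?_, fun v _ => ?_, fun t ht v _ => ?_, ?_⟩
    · have h1 : LipschitzWith M (A t) :=
        (A t).lipschitz.weaken (by exact_mod_cast hM t ht)
      exact h1.comp_lipschitzOnWith hK
    · exact (hA.clm_apply continuous_const).continuousOn
    · calc ‖A t (P v)‖ ≤ ‖A t‖ * ‖P v‖ := (A t).le_opNorm _
        _ ≤ M * 1 := by
          gcongr
          · exact hM t ht
          · exact hP1 v
        _ = M := mul_one _
    · simp
  obtain ⟨y, hy0, hy⟩ := hPL.exists_eq_forall_mem_Icc_hasDerivWithinAt₀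
  have hy' : ∀ t ∈ Set.Ioo (-(T : ℝ)) T, HasDerivAt y (A t (P (y t))) t := fun t ht =>
    (hy t (Set.Ioo_subset_Icc_self ht)).hasDerivAt (Icc_mem_nhds ht.1 ht.2)
  refine ⟨y, hy0, fun t ht => ?_⟩
  have hnorm : ‖y t‖ ^ 2 = ‖y 0‖ ^ 2 :=
    norm_sq_eq_of_inner_deriv_eq_zero hy' (fun s _ => by simp [P, hskew, inner_smul_right]) ht
  have hPy : P (y t) = y t := by
    have hy0' : y 0 = x₀ := hy0
    simp only [P, hnorm, hy0', hx₀]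
    norm_num
  simpa [hPy] using hy' t ht

/-- A linear system with continuous skew-symmetric coefficients is globally solvable for unit
initial data. -/
theorem exists_hasDerivAt_of_skew {E : Type*} [NormedAddCommGroup E]
    [InnerProductSpace ℝ E] [FiniteDimensional ℝ E] {A : ℝ → E →L[ℝ] E} (hA : Continuous A)
    (hskew : ∀ t v, ⟪v, A t v⟫ = 0) {x₀ : E} (hx₀ : ‖x₀‖ = 1) :
    ∃ y : ℝ → E, y 0 = x₀ ∧ ∀ t, HasDerivAt y (A t (y t)) t := by
  choose y hy0 hy using fun N : ℕ =>
    exists_hasDerivAt_Ioo_of_skew hA hskew hx₀ (T := N) N.cast_nonneg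
  have hagree : ∀ {N M : ℕ} {t : ℝ}, |t| < N → |t| < M → y N t = y M t := fun {N M t} hN hM => by
    have hd : ∀ s ∈ Set.Ioo (-(min (N : ℝ) M)) (min (N : ℝ) M),
        HasDerivAt (fun s => y N s - y M s) (A s (y N s - y M s)) s := fun s hs => by
      rw [map_sub]
      have hs' := lt_min_iff.1 (abs_lt.2 hs)
      exact (hy N s (abs_lt.1 hs'.1)).sub (hy M s (abs_lt.1 hs'.2))
    have := norm_sq_eq_of_inner_deriv_eq_zero hd (fun s _ => hskew _ _)
      (abs_lt.1 (lt_min hN hM))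
    simpa [hy0, sub_eq_zero] using this
  have hlt : ∀ t : ℝ, |t| < (⌊|t|⌋₊ + 1 : ℕ) := fun t => by
    exact_mod_cast Nat.lt_floor_add_one |t|
  refine ⟨fun t => y (⌊|t|⌋₊ + 1) t, hy0 _, fun t => ?_⟩
  refine (hy _ t (abs_lt.1 (hlt t))).congr_of_eventuallyEq ?_
  filter_upwards [continuous_abs.continuousAt.eventually_lt_const (hlt t)] with s hs
  exact hagree (hlt s) hs

/-- Solutions of a linear system with smooth coefficients are smooth. -/
theorem contDiff_of_hasDerivAt_clm {E : Type*} [NormedAddCommGroup E] [NormedSpace ℝ E]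
    {A : ℝ → E →L[ℝ] E} (hA : ContDiff ℝ (⊤ : ℕ∞) A) {y : ℝ → E}
    (hy : ∀ t, HasDerivAt y (A t (y t)) t) : ContDiff ℝ (⊤ : ℕ∞) y := by
  refine contDiff_infty.2 fun n => ?_
  induction n with
  | zero => exact contDiff_zero.2 (continuous_iff_continuousAt.2 fun t => (hy t).continuousAt)
  | succ n ih =>
    push_cast
    refine contDiff_succ_iff_deriv.2 ⟨fun t => (hy t).differentiableAt, by simp, ?_⟩
    rw [funext fun t => (hy t).deriv]
    exact (contDiff_infty.1 hA n).clm_apply ih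

/-- The coefficient operator of the Serret–Frenet system, acting on one coordinate of
`(m, n, b)`. -/
def frenetCLM (k τ : ℝ) : E3 →L[ℝ] E3 :=
  LinearMap.toContinuousLinearMap
    { toFun := fun v => toE3 ![k * v 1, -k * v 0 + τ * v 2, -τ * v 1]
      map_add' := fun v w => by
        ext i; fin_cases i <;> simp [toE3] <;> ring
      map_smul' := fun r v => by
        ext i; fin_cases i <;> simp [toE3] <;> ring }

theorem frenetCLM_apply (k τ : ℝ) (v : E3) :
    frenetCLM k τ v = toE3 ![k * v 1, -k * v 0 + τ * v 2, -τ * v 1] := rfl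

theorem frenetCLM_eq_smul_add_smul (k τ : ℝ) :
    frenetCLM k τ = k • frenetCLM 1 0 + τ • frenetCLM 0 1 := by
  ext v i
  fin_cases i <;> simp [frenetCLM_apply, toE3]

theorem inner_E3 (v w : E3) : ⟪v, w⟫ = v 0 * w 0 + v 1 * w 1 + v 2 * w 2 := by
  simp [PiLp.inner_apply, Fin.sum_univ_three, mul_comm]

theorem inner_frenetCLM_self (k τ : ℝ) (v : E3) : ⟪v, frenetCLM k τ v⟫ = 0 := by
  rw [inner_E3]
  simp [frenetCLM_apply, toE3]
  ring

theorem contDiff_frenetCLM (α β c : ℝ) :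
    ContDiff ℝ (⊤ : ℕ∞)
      (fun x : ℝ => frenetCLM (c * Real.exp (-α * x ^ 2 / 4)) (β * x / 2)) := by
  simp_rw [frenetCLM_eq_smul_add_smul (_ * _)]
  fun_prop

theorem hasDerivAt_E3 {f : ℝ → E3} {f' : E3} {x : ℝ} :
    HasDerivAt f f' x ↔ ∀ i, HasDerivAt (fun y => f y i) (f' i) x := by
  simp only [hasDerivAt_iff_hasFDerivAt, ← hasFDerivWithinAt_univ]
  rw [hasFDerivWithinAt_euclidean]
  refine forall_congr' fun i => ?_
  have : ContinuousLinearMap.toSpanSingleton ℝ (f' i) =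
      (EuclideanSpace.proj i : E3 →L[ℝ] ℝ) ∘L ContinuousLinearMap.toSpanSingleton ℝ f' := by
    ext
    simp
  rw [this]

theorem HasDerivAt.cross {f g : ℝ → E3} {f' g' : E3} {x : ℝ} (hf : HasDerivAt f f' x)
    (hg : HasDerivAt g g' x) :
    HasDerivAt (fun y => cross (f y) (g y)) (cross f' (g x) + cross (f x) g') x := by
  rw [hasDerivAt_E3] at *
  intro i
  fin_cases i
  · refine (((hf 1).mul (hg 2)).sub ((hf 2).mul (hg 1))).congr_deriv ?_
    simp [_root_.cross, toE3]; ring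
  · refine (((hf 2).mul (hg 0)).sub ((hf 0).mul (hg 2))).congr_deriv ?_
    simp [_root_.cross, toE3]; ring
  · refine (((hf 0).mul (hg 1)).sub ((hf 1).mul (hg 0))).congr_deriv ?_
    simp [_root_.cross, toE3]; ring

theorem IsSF.unique {α β c : ℝ} {m n b m' n' b' : ℝ → E3} (h : IsSF α β c m n b)
    (h' : IsSF α β c m' n' b') : m' = m ∧ n' = n ∧ b' = b := by
  obtain ⟨hm, hn, hb, hm0, hn0, hb0⟩ := h
  obtain ⟨hm', hn', hb', hm0', hn0', hb0'⟩ := h'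
  have hd : ∀ x, HasDerivAt
      (fun x => ‖m' x - m x‖ ^ 2 + ‖n' x - n x‖ ^ 2 + ‖b' x - b x‖ ^ 2) 0 x := fun x => by
    refine ((((hm' x).sub (hm x)).norm_sq.add ((hn' x).sub (hn x)).norm_sq).add
      ((hb' x).sub (hb x)).norm_sq).congr_deriv ?_
    simp [inner_E3]
    ring
  have hzero : ∀ x, ‖m' x - m x‖ ^ 2 + ‖n' x - n x‖ ^ 2 + ‖b' x - b x‖ ^ 2 = 0 := fun x => by
    rw [is_const_of_deriv_eq_zero (fun x => (hd x).differentiableAt) (fun x => (hd x).deriv) x 0]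
    simp [*]
  have hsq : ∀ v : E3, 0 ≤ ‖v‖ ^ 2 := fun v => sq_nonneg _
  refine ⟨funext fun x => ?_, funext fun x => ?_, funext fun x => ?_⟩ <;>
  · rw [← sub_eq_zero, ← norm_eq_zero, ← sq_eq_zero_iff]
    linarith [hzero x, hsq (m' x - m x), hsq (n' x - n x), hsq (b' x - b x)]

/-- The frame of cross products solves the same Serret–Frenet system. -/
theorem IsSF.cross {α β c : ℝ} {m n b : ℝ → E3} (h : IsSF α β c m n b) :
    IsSF α β c (fun x => cross (n x) (b x)) (fun x => cross (b x) (m x))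
      (fun x => cross (m x) (n x)) := by
  obtain ⟨hm, hn, hb, hm0, hn0, hb0⟩ := h
  refine ⟨fun x => ?_, fun x => ?_, fun x => ?_, ?_, ?_, ?_⟩
  · refine ((hn x).cross (hb x)).congr_deriv ?_
    ext i; fin_cases i <;> simp [_root_.cross, toE3] <;> ring
  · refine ((hb x).cross (hm x)).congr_deriv ?_
    ext i; fin_cases i <;> simp [_root_.cross, toE3] <;> ring
  · refine ((hm x).cross (hn x)).congr_deriv ?_
    ext i; fin_cases i <;> simp [_root_.cross, toE3] <;> ring
  all_goals
    simp only [hm0, hn0, hb0]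
    ext i; fin_cases i <;> simp [_root_.cross, toE3, e1, e2, e3]

theorem exists_isSF (α β c : ℝ) :
    ∃ m n b : ℝ → E3, IsSF α β c m n b ∧
      ContDiff ℝ (⊤ : ℕ∞) m ∧ ContDiff ℝ (⊤ : ℕ∞) n ∧ ContDiff ℝ (⊤ : ℕ∞) b := by
  have hA := contDiff_frenetCLM α β c
  choose u hu0 hu using fun j : Fin 3 =>
    exists_hasDerivAt_of_skew hA.continuous (fun x v => inner_frenetCLM_self _ _ v)
      (x₀ := EuclideanSpace.single j (1 : ℝ)) (by simp)
  have hsmooth : ∀ j i, ContDiff ℝ (⊤ : ℕ∞) fun x => u j x i := fun j =>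
    contDiff_euclidean.1 (contDiff_of_hasDerivAt_clm hA (hu j))
  have hcoord := fun j x => hasDerivAt_E3.1 (hu j x)
  let w : Fin 3 → ℝ → E3 := fun i x => toE3 fun j => u j x i
  have hw : ∀ i, ContDiff ℝ (⊤ : ℕ∞) (w i) := fun i =>
    contDiff_euclidean.2 fun j => hsmooth j i
  refine ⟨w 0, w 1, w 2, ⟨fun x => hasDerivAt_E3.2 fun j => ?_,
    fun x => hasDerivAt_E3.2 fun j => ?_, fun x => hasDerivAt_E3.2 fun j => ?_, ?_, ?_, ?_⟩,
    hw 0, hw 1, hw 2⟩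
  · simpa [frenetCLM_apply, toE3, w] using hcoord j x 0
  · simpa [frenetCLM_apply, toE3, w] using hcoord j x 1
  · simpa [frenetCLM_apply, toE3, w] using hcoord j x 2
  all_goals
    ext j; fin_cases j <;> simp [w, hu0, toE3, e1, e2, e3]

theorem IsSF.orthonormal {α β c : ℝ} {m n b : ℝ → E3} (h : IsSF α β c m n b) (x : ℝ) :
    ‖m x‖ = 1 ∧ ‖n x‖ = 1 ∧ ‖b x‖ = 1 ∧
      ⟪m x, n x⟫ = 0 ∧ ⟪m x, b x⟫ = 0 ∧ ⟪n x, b x⟫ = 0 := by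
  obtain ⟨hm, hn, hb, hm0, hn0, hb0⟩ := h
  let Φ : ℝ → Matrix (Fin 3) (Fin 3) ℝ := fun x => Matrix.of ![m x, n x, b x]
  have hΦ : (Φ x).transpose * Φ x = 1 := by
    ext i j
    have hd : ∀ x, HasDerivAt (fun x => m x i * m x j + n x i * n x j + b x i * b x j) 0 x :=
      fun x => by
        have hm := hasDerivAt_E3.1 (hm x)
        have hn := hasDerivAt_E3.1 (hn x)
        have hb := hasDerivAt_E3.1 (hb x)
        refine ((((hm i).mul (hm j)).add ((hn i).mul (hn j))).add
            ((hb i).mul (hb j))).congr_deriv ?_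
        simp
        ring
    have hx :=
      is_const_of_deriv_eq_zero (fun x => (hd x).differentiableAt) (fun x => (hd x).deriv) x 0
    have : ((Φ x).transpose * Φ x) i j = m x i * m x j + n x i * n x j + b x i * b x j := by
      simp [Φ, Matrix.mul_apply, Fin.sum_univ_three]
    rw [this, hx, hm0, hn0, hb0]
    fin_cases i <;> fin_cases j <;> simp [e1, e2, e3]
  have hΦ' := mul_eq_one_comm.1 hΦ
  have key := fun i j => congrFun (congrFun hΦ' i) j
  have hnorm : ∀ v : E3, ⟪v, v⟫ = 1 → ‖v‖ = 1 := fun v hv => by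
    rw [real_inner_self_eq_norm_sq] at hv
    exact (pow_eq_one_iff_of_nonneg (norm_nonneg v) two_ne_zero).1 hv
  refine ⟨hnorm _ ?_, hnorm _ ?_, hnorm _ ?_, ?_, ?_, ?_⟩ <;> rw [inner_E3]
  · simpa [Φ, Matrix.mul_apply, Fin.sum_univ_three] using key 0 0
  · simpa [Φ, Matrix.mul_apply, Fin.sum_univ_three] using key 1 1
  · simpa [Φ, Matrix.mul_apply, Fin.sum_univ_three] using key 2 2
  · simpa [Φ, Matrix.mul_apply, Fin.sum_univ_three] using key 0 1
  · simpa [Φ, Matrix.mul_apply, Fin.sum_univ_three] using key 0 2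
  · simpa [Φ, Matrix.mul_apply, Fin.sum_univ_three] using key 1 2

theorem IsSF.norm_deriv {α β c : ℝ} {m n b : ℝ → E3} (h : IsSF α β c m n b) (hc : 0 < c)
    (x : ℝ) : ‖deriv m x‖ = c * Real.exp (-α * x ^ 2 / 4) := by
  rw [(h.1 x).deriv, norm_smul, (h.orthonormal x).2.1, mul_one]
  exact Real.norm_of_nonneg (by positivity)

theorem hasDerivAt_curvature (α c x : ℝ) :
    HasDerivAt (fun x : ℝ => c * Real.exp (-α * x ^ 2 / 4))
      (-(α * x / 2) * (c * Real.exp (-α * x ^ 2 / 4))) x := by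
  refine (((((hasDerivAt_pow 2 x).const_mul (-α)).div_const 4).exp).const_mul c).congr_deriv ?_
  push_cast
  ring

theorem IsSF.expander_profile {α β c : ℝ} {m n b : ℝ → E3} (h : IsSF α β c m n b)
    (hc : 0 < c) (hαβ : α ^ 2 + β ^ 2 = 1) (x : ℝ) :
    α • deriv (deriv m) x + (α * ‖deriv m x‖ ^ 2) • m x
      + β • deriv (fun y => _root_.cross (m y) (deriv m y)) x + (x / 2) • deriv m x = 0 := by
  have hdm : deriv m = fun x => (c * Real.exp (-α * x ^ 2 / 4)) • n x :=
    funext fun x => (h.1 x).deriv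
  have hcr : (fun y => _root_.cross (m y) (deriv m y)) =
      fun y => (c * Real.exp (-α * y ^ 2 / 4)) • b y := by
    funext y
    rw [← (h.unique h.cross).2.2, hdm]
    ext i; fin_cases i <;> simp [_root_.cross, toE3] <;> ring
  have hk := hasDerivAt_curvature α c x
  rw [h.norm_deriv hc, hcr, (hk.fun_smul (h.2.2.1 x)).deriv, hdm,
    (hk.fun_smul (h.2.1 x)).deriv]
  beta_reduce
  generalize c * Real.exp (-α * x ^ 2 / 4) = k
  match_scalars
  · ring
  · ring
  · linear_combination (-(x / 2) * k) * hαβ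

/-- the Serret–Frenet system with curvature `c e^{-αx²/4}` and torsion `βx/2`
has a unique global solution; it is smooth, orthonormal at every point, and its first
component solves the expander profile equation with `|m'(x)| = c e^{-αx²/4}`. -/
theorem serret_frenet_expander_profile
    (α β c : ℝ) (hα : α ∈ Set.Icc (0 : ℝ) 1) (hβ : β = Real.sqrt (1 - α ^ 2)) (hc : 0 < c) :
    ∃ m n b : ℝ → E3, IsSF α β c m n b ∧
      ContDiff ℝ (⊤ : ℕ∞) m ∧ ContDiff ℝ (⊤ : ℕ∞) n ∧ ContDiff ℝ (⊤ : ℕ∞) b ∧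
      (∀ x : ℝ, ‖m x‖ = 1 ∧ ‖n x‖ = 1 ∧ ‖b x‖ = 1 ∧
        ⟪m x, n x⟫ = 0 ∧ ⟪m x, b x⟫ = 0 ∧ ⟪n x, b x⟫ = 0) ∧
      (∀ x : ℝ,
        α • deriv (deriv m) x + (α * ‖deriv m x‖ ^ 2) • m x
          + β • deriv (fun y => cross (m y) (deriv m y)) x + (x / 2) • deriv m x = 0) ∧
      (∀ x : ℝ, ‖deriv m x‖ = c * Real.exp (-α * x ^ 2 / 4)) ∧
      (∀ m' n' b' : ℝ → E3, IsSF α β c m' n' b' → m' = m ∧ n' = n ∧ b' = b) := by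
  obtain ⟨m, n, b, h, hm, hn, hb⟩ := exists_isSF α β c
  have hαβ : α ^ 2 + β ^ 2 = 1 := by
    rw [hβ, Real.sq_sqrt (by nlinarith [hα.1, hα.2])]
    ring
  exact ⟨m, n, b, h, hm, hn, hb, h.orthonormal, h.expander_profile hc hαβ, h.norm_deriv hc,
    fun _ _ _ h' => h.unique h'⟩
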